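/- arXiv:2412.16314 — 4 statements merged into one kernel-verified Lean document; each statement's English description precedes it below -/
import Mathlib

section
/- Let n ≥ 3 be a natural number, and in SL₂(ℤ) let A = [[1, -n], [0, 1]] and B = [[1, 0], [n, 1]], and let Λₙ be the subgroup of SL₂(ℤ) generated by A and B. Then the real number (n² - 2 + n·√(n² - 4))/2 is the least element of the set of real numbers { (|tr γ| + √((tr γ)² - 4))/2 : γ ∈ Λₙ, |tr γ| > 2 }; that is, it is a lower bound for this set and is attained by some hyperbolic element of Λₙ. -/
open Matrix

/-- `A = [[1, -n], [0, 1]]` as an element of `SL₂(ℤ)`. -/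
def Amat (n : ℕ) : Matrix.SpecialLinearGroup (Fin 2) ℤ :=
  ⟨!![1, -(n:ℤ); 0, 1], by simp [Matrix.det_fin_two_of]⟩

/-- `B = [[1, 0], [n, 1]]` as an element of `SL₂(ℤ)`. -/
def Bmat (n : ℕ) : Matrix.SpecialLinearGroup (Fin 2) ℤ :=
  ⟨!![1, 0; (n:ℤ), 1], by simp [Matrix.det_fin_two_of]⟩

/-- `Λₙ`, the subgroup of `SL₂(ℤ)` generated by `A` and `B`. -/
def Lam (n : ℕ) : Subgroup (Matrix.SpecialLinearGroup (Fin 2) ℤ) :=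
  Subgroup.closure {Amat n, Bmat n}

/-- Elements of `Λₙ` have diagonal entries `≡ 1 mod n²` and off-diagonal entries `≡ 0 mod n`. -/
lemma Lam_entries_congr {n : ℕ} {γ : Matrix.SpecialLinearGroup (Fin 2) ℤ} (hγ : γ ∈ Lam n) :
    ∃ a b c d : ℤ,
      (γ : Matrix (Fin 2) (Fin 2) ℤ) = !![1 + (n : ℤ) ^ 2 * a, n * b; n * c, 1 + (n : ℤ) ^ 2 * d] := by
  induction hγ using Subgroup.closure_induction with
  | mem x hx =>
    rcases hx with rfl | rfl
    · exact ⟨0, -1, 0, 0, by simp [Amat]⟩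
    · exact ⟨0, 0, 1, 0, by simp [Bmat]⟩
  | one => exact ⟨0, 0, 0, 0, by simp [Matrix.one_fin_two]⟩
  | mul x y _ _ hx hy =>
    obtain ⟨a, b, c, d, hx⟩ := hx
    obtain ⟨a', b', c', d', hy⟩ := hy
    refine ⟨a + a' + n ^ 2 * a * a' + b * c', b' + b + n ^ 2 * (a * b' + b * d'),
      c + c' + n ^ 2 * (c * a' + d * c'), d + d' + n ^ 2 * d * d' + c * b', ?_⟩
    rw [Matrix.SpecialLinearGroup.coe_mul, hx, hy, Matrix.mul_fin_two]
    ext i j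
    fin_cases i <;> fin_cases j <;> simp <;> ring
  | inv x _ hx =>
    obtain ⟨a, b, c, d, hx⟩ := hx
    exact ⟨d, -b, -c, a, by simp [Matrix.SpecialLinearGroup.coe_inv, hx, Matrix.adjugate_fin_two_of]⟩

/-- Traces of elements of `Λₙ` are `≡ 2 mod n²`. -/
lemma Lam_trace_congr {n : ℕ} {γ : Matrix.SpecialLinearGroup (Fin 2) ℤ} (hγ : γ ∈ Lam n) :
    ∃ k : ℤ, Matrix.trace (γ : Matrix (Fin 2) (Fin 2) ℤ) = 2 + (n : ℤ) ^ 2 * k := by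
  obtain ⟨a, b, c, d, h⟩ := Lam_entries_congr hγ
  exact ⟨a + d, by rw [h, Matrix.trace_fin_two_of]; ring⟩

lemma le_abs_trace_of_mem_Lam {n : ℕ} {γ : Matrix.SpecialLinearGroup (Fin 2) ℤ} (hγ : γ ∈ Lam n)
    (h : 2 < |Matrix.trace (γ : Matrix (Fin 2) (Fin 2) ℤ)|) :
    (n : ℤ) ^ 2 - 2 ≤ |Matrix.trace (γ : Matrix (Fin 2) (Fin 2) ℤ)| := by
  obtain ⟨k, hk⟩ := Lam_trace_congr hγ
  rw [hk] at h ⊢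
  have hn : 0 ≤ (n : ℤ) ^ 2 := by positivity
  rcases lt_trichotomy k 0 with hk | rfl | hk
  · refine le_trans ?_ (neg_le_abs _)
    nlinarith
  · norm_num at h
  · refine le_trans ?_ (le_abs_self _)
    nlinarith

lemma trace_Amat_mul_Bmat (n : ℕ) :
    Matrix.trace ((Amat n * Bmat n : Matrix.SpecialLinearGroup (Fin 2) ℤ) :
      Matrix (Fin 2) (Fin 2) ℤ) = 2 - (n : ℤ) ^ 2 := by
  rw [Matrix.SpecialLinearGroup.coe_mul]
  simp only [Amat, Bmat, Matrix.mul_fin_two, Matrix.trace_fin_two_of]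
  ring

/-- The real number `(n² - 2 + n·√(n² - 4))/2` is the least element of the set of
spectral radii `(|tr γ| + √((tr γ)² - 4))/2` of hyperbolic elements `γ ∈ Λₙ`. -/
theorem stmt_0 (n : ℕ) (hn : 3 ≤ n) :
    IsLeast
      { x : ℝ | ∃ γ ∈ Lam n,
          2 < |Matrix.trace (γ : Matrix (Fin 2) (Fin 2) ℤ)| ∧
          x = (((|Matrix.trace (γ : Matrix (Fin 2) (Fin 2) ℤ)| : ℤ) : ℝ) +
                Real.sqrt (((Matrix.trace (γ : Matrix (Fin 2) (Fin 2) ℤ) : ℤ) : ℝ) ^ 2 - 4)) / 2 }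
      (((n : ℝ) ^ 2 - 2 + (n : ℝ) * Real.sqrt ((n : ℝ) ^ 2 - 4)) / 2) := by
  have hn' : (3 : ℤ) ≤ n := by exact_mod_cast hn
  have hsqrt : (n : ℝ) * √((n : ℝ) ^ 2 - 4) = √(((n : ℝ) ^ 2 - 2) ^ 2 - 4) := by
    rw [show ((n : ℝ) ^ 2 - 2) ^ 2 - 4 = (n : ℝ) ^ 2 * ((n : ℝ) ^ 2 - 4) by ring,
      Real.sqrt_mul (by positivity), Real.sqrt_sq (by positivity)]
  rw [hsqrt]
  constructor
  · have habs : |(2 : ℤ) - (n : ℤ) ^ 2| = (n : ℤ) ^ 2 - 2 := by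
      rw [abs_of_nonpos (by nlinarith)]
      ring
    refine ⟨Amat n * Bmat n, mul_mem (Subgroup.subset_closure (by simp))
      (Subgroup.subset_closure (by simp)), ?_, ?_⟩
    · rw [trace_Amat_mul_Bmat, habs]
      nlinarith
    · rw [trace_Amat_mul_Bmat, habs]
      push_cast
      rw [sub_sq_comm (2 : ℝ)]
  · rintro x ⟨γ, hγ, htr, rfl⟩
    have hle : (n : ℝ) ^ 2 - 2 ≤ ((|Matrix.trace (γ : Matrix (Fin 2) (Fin 2) ℤ)| : ℤ) : ℝ) := by
      exact_mod_cast le_abs_trace_of_mem_Lam hγ htr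
    have hnonneg : (0 : ℝ) ≤ (n : ℝ) ^ 2 - 2 := by
      have : (3 : ℝ) ≤ n := by exact_mod_cast hn
      nlinarith
    rw [← sq_abs ((Matrix.trace (γ : Matrix (Fin 2) (Fin 2) ℤ) : ℤ) : ℝ), ← Int.cast_abs]
    gcongr
end

section
/- Let n ≥ 3 be a natural number, and in SL₂(ℤ) let A = [[1, -n], [0, 1]] and B = [[1, 0], [n, 1]], and let Λₙ be the subgroup of SL₂(ℤ) generated by A and B. Then every γ ∈ Λₙ has the form [[1 + k₁n², k₂n], [k₃n, 1 + k₄n²]] for some integers k₁, k₂, k₃, k₄; equivalently, the two diagonal entries of γ are congruent to 1 modulo n² and the two off-diagonal entries are divisible by n. -/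
open Matrix

/-- Every element of `Λₙ` (for `n ≥ 3`) has the form
`[[1 + k₁n², k₂n], [k₃n, 1 + k₄n²]]` with `k₁, k₂, k₃, k₄ ∈ ℤ`. -/
theorem stmt_1 (n : ℕ) (hn : 3 ≤ n) :
    ∀ γ ∈ Lam n, ∃ k₁ k₂ k₃ k₄ : ℤ,
      (γ : Matrix (Fin 2) (Fin 2) ℤ) =
        !![1 + k₁ * (n : ℤ) ^ 2, k₂ * (n : ℤ); k₃ * (n : ℤ), 1 + k₄ * (n : ℤ) ^ 2] := by
  intro γ hγ
  induction hγ using Subgroup.closure_induction with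
  | mem x hx =>
    rcases hx with rfl | rfl
    · exact ⟨0, -1, 0, 0, by simp [Amat]⟩
    · exact ⟨0, 0, 1, 0, by simp [Bmat]⟩
  | one => exact ⟨0, 0, 0, 0, by simp [Matrix.one_fin_two]⟩
  | mul x y _ _ hx hy =>
    obtain ⟨a, b, c, d, hx⟩ := hx
    obtain ⟨a', b', c', d', hy⟩ := hy
    refine ⟨a + a' + a * a' * (n : ℤ) ^ 2 + b * c',
      b' + b + (a * b' + b * d') * (n : ℤ) ^ 2,
      c + c' + (c * a' + d * c') * (n : ℤ) ^ 2,
      d + d' + d * d' * (n : ℤ) ^ 2 + c * b', ?_⟩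
    rw [Matrix.SpecialLinearGroup.coe_mul, hx, hy, Matrix.mul_fin_two]
    ext i j
    fin_cases i <;> fin_cases j <;> simp <;> ring
  | inv x _ hx =>
    obtain ⟨a, b, c, d, hx⟩ := hx
    refine ⟨d, -b, -c, a, ?_⟩
    rw [Matrix.SpecialLinearGroup.coe_inv, hx, Matrix.adjugate_fin_two_of]
    simp only [neg_mul]
end

section
/- Let n ≥ 3 be a natural number, and in SL₂(ℤ) let A = [[1, -n], [0, 1]] and B = [[1, 0], [n, 1]], and let Λₙ be the subgroup of SL₂(ℤ) generated by A and B. Then for every γ ∈ Λₙ with |tr γ| > 2, one has |tr γ| ≥ n² - 2. -/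
open Matrix

/-- Elements of `Λₙ` have diagonal entries `≡ 1 mod n²` and off-diagonal entries `≡ 0 mod n`. -/
theorem exists_entries_of_mem_Lam (n : ℕ) {γ : Matrix.SpecialLinearGroup (Fin 2) ℤ}
    (hγ : γ ∈ Lam n) :
    ∃ a b c d : ℤ, γ 0 0 = 1 + n ^ 2 * a ∧ γ 0 1 = n * b ∧ γ 1 0 = n * c ∧
      γ 1 1 = 1 + n ^ 2 * d := by
  induction hγ using Subgroup.closure_induction with
  | mem x hx =>
    rcases hx with rfl | rfl
    · exact ⟨0, -1, 0, 0, by simp [Amat]⟩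
    · exact ⟨0, 0, 1, 0, by simp [Bmat]⟩
  | one => exact ⟨0, 0, 0, 0, by simp⟩
  | mul x y _ _ hx hy =>
    obtain ⟨a, b, c, d, h1, h2, h3, h4⟩ := hx
    obtain ⟨a', b', c', d', h1', h2', h3', h4'⟩ := hy
    refine ⟨a + a' + n ^ 2 * a * a' + b * c', b' + n ^ 2 * a * b' + b + n ^ 2 * b * d',
      c + n ^ 2 * c * a' + c' + n ^ 2 * d * c', d + d' + n ^ 2 * d * d' + c * b',
      ?_, ?_, ?_, ?_⟩ <;>
    · simp only [Matrix.SpecialLinearGroup.coe_mul, Matrix.mul_apply, Fin.sum_univ_two,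
        h1, h2, h3, h4, h1', h2', h3', h4']
      ring
  | inv x _ hx =>
    obtain ⟨a, b, c, d, h1, h2, h3, h4⟩ := hx
    refine ⟨d, -b, -c, a, ?_⟩
    simp [Matrix.SpecialLinearGroup.coe_inv, Matrix.adjugate_fin_two, h1, h2, h3, h4]

/-- Every hyperbolic element of `Λₙ` (for `n ≥ 3`) has trace magnitude at least `n² - 2`. -/
theorem stmt_6 (n : ℕ) (hn : 3 ≤ n) :
    ∀ γ ∈ Lam n, 2 < |Matrix.trace (γ : Matrix (Fin 2) (Fin 2) ℤ)| →
      (n : ℤ) ^ 2 - 2 ≤ |Matrix.trace (γ : Matrix (Fin 2) (Fin 2) ℤ)| := by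
  intro γ hγ htr
  obtain ⟨a, b, c, d, h1, -, -, h4⟩ := exists_entries_of_mem_Lam n hγ
  have ht : Matrix.trace (γ : Matrix (Fin 2) (Fin 2) ℤ) = 2 + n ^ 2 * (a + d) := by
    rw [Matrix.trace_fin_two, h1, h4]
    ring
  rw [ht] at htr ⊢
  have hsq : (0 : ℤ) ≤ (n : ℤ) ^ 2 := sq_nonneg _
  rcases lt_trichotomy (a + d) 0 with h | h | h
  · refine le_trans ?_ (neg_le_abs _)
    nlinarith
  · simp [h] at htr
  · refine le_trans ?_ (le_abs_self _)
    nlinarith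
end

section
/- Let n ≥ 3 be a natural number, and in SL₂(ℤ) let A = [[1, -n], [0, 1]] and B = [[1, 0], [n, 1]], and let Λₙ be the subgroup of SL₂(ℤ) generated by A and B. Then the product A·B equals the matrix [[1 - n², -n], [n, 1]]; in particular A·B is an element of Λₙ whose trace is 2 - n², so that |tr(A·B)| = n² - 2 > 2, i.e., A·B is hyperbolic and realizes the minimal trace magnitude n² - 2 among hyperbolic elements of Λₙ. -/
open Matrix

/-- Elements of `Λₙ` have diagonal entries congruent to `1` modulo `n²` and off-diagonal
entries divisible by `n`. -/
theorem entries_of_mem_Lam {n : ℕ} {γ : Matrix.SpecialLinearGroup (Fin 2) ℤ} (hγ : γ ∈ Lam n) :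
    (n : ℤ) ^ 2 ∣ γ 0 0 - 1 ∧ (n : ℤ) ∣ γ 0 1 ∧ (n : ℤ) ∣ γ 1 0 ∧ (n : ℤ) ^ 2 ∣ γ 1 1 - 1 := by
  induction hγ using Subgroup.closure_induction with
  | mem x hx =>
    rcases hx with rfl | rfl <;> simp [Amat, Bmat]
  | one => simp
  | mul x y _ _ hx hy =>
    obtain ⟨⟨a, ha⟩, ⟨b, hb⟩, ⟨c, hc⟩, ⟨d, hd⟩⟩ := hx
    obtain ⟨⟨a', ha'⟩, ⟨b', hb'⟩, ⟨c', hc'⟩, ⟨d', hd'⟩⟩ := hy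
    rw [sub_eq_iff_eq_add] at ha hd ha' hd'
    simp only [Matrix.SpecialLinearGroup.coe_mul, Matrix.mul_apply, Fin.sum_univ_two,
      ha, hb, hc, hd, ha', hb', hc', hd']
    refine ⟨⟨n ^ 2 * a * a' + a + a' + b * c', by ring⟩,
      ⟨n ^ 2 * a * b' + b' + n ^ 2 * b * d' + b, by ring⟩,
      ⟨n ^ 2 * c * a' + c + n ^ 2 * d * c' + c', by ring⟩,
      ⟨c * b' + n ^ 2 * d * d' + d + d', by ring⟩⟩
  | inv x _ hx =>
    obtain ⟨ha, hb, hc, hd⟩ := hx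
    simpa [Matrix.SpecialLinearGroup.coe_inv, Matrix.adjugate_fin_two] using
      And.intro hd ⟨hb, hc, ha⟩

/-- Traces of elements of `Λₙ` are congruent to `2` modulo `n²`. -/
theorem sq_dvd_trace_sub_two_of_mem_Lam {n : ℕ} {γ : Matrix.SpecialLinearGroup (Fin 2) ℤ}
    (hγ : γ ∈ Lam n) :
    (n : ℤ) ^ 2 ∣ Matrix.trace (γ : Matrix (Fin 2) (Fin 2) ℤ) - 2 := by
  obtain ⟨⟨a, ha⟩, -, -, ⟨d, hd⟩⟩ := entries_of_mem_Lam hγ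
  refine ⟨a + d, ?_⟩
  rw [Matrix.trace_fin_two]
  change γ 0 0 + γ 1 1 - 2 = _
  linear_combination ha + hd

/-- `A·B = [[1 - n², -n], [n, 1]]`; it lies in `Λₙ`, has trace `2 - n²`, has
`|tr(A·B)| = n² - 2 > 2` (so it is hyperbolic), and it realizes the minimal trace
magnitude among hyperbolic elements of `Λₙ`. -/
theorem stmt_7 (n : ℕ) (hn : 3 ≤ n) :
    ((Amat n * Bmat n : Matrix.SpecialLinearGroup (Fin 2) ℤ) : Matrix (Fin 2) (Fin 2) ℤ) =
        !![1 - (n : ℤ) ^ 2, -(n : ℤ); (n : ℤ), 1] ∧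
    Amat n * Bmat n ∈ Lam n ∧
    Matrix.trace ((Amat n * Bmat n : Matrix.SpecialLinearGroup (Fin 2) ℤ) :
        Matrix (Fin 2) (Fin 2) ℤ) = 2 - (n : ℤ) ^ 2 ∧
    |Matrix.trace ((Amat n * Bmat n : Matrix.SpecialLinearGroup (Fin 2) ℤ) :
        Matrix (Fin 2) (Fin 2) ℤ)| = (n : ℤ) ^ 2 - 2 ∧
    2 < (n : ℤ) ^ 2 - 2 ∧
    ∀ γ ∈ Lam n, 2 < |Matrix.trace (γ : Matrix (Fin 2) (Fin 2) ℤ)| →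
      (n : ℤ) ^ 2 - 2 ≤ |Matrix.trace (γ : Matrix (Fin 2) (Fin 2) ℤ)| := by
  have hn2 : (9 : ℤ) ≤ (n : ℤ) ^ 2 := by
    have : (3 : ℤ) ≤ n := by exact_mod_cast hn
    nlinarith
  have hAB : ((Amat n * Bmat n : Matrix.SpecialLinearGroup (Fin 2) ℤ) :
      Matrix (Fin 2) (Fin 2) ℤ) = !![1 - (n : ℤ) ^ 2, -(n : ℤ); (n : ℤ), 1] := by
    rw [Matrix.SpecialLinearGroup.coe_mul]
    simp [Amat, Bmat, sq, sub_eq_add_neg]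
  have htr : Matrix.trace ((Amat n * Bmat n : Matrix.SpecialLinearGroup (Fin 2) ℤ) :
      Matrix (Fin 2) (Fin 2) ℤ) = 2 - (n : ℤ) ^ 2 := by
    rw [hAB, Matrix.trace_fin_two_of]
    ring
  refine ⟨hAB, mul_mem (Subgroup.subset_closure (by simp)) (Subgroup.subset_closure (by simp)),
    htr, ?_, by linarith, fun γ hγ hhyp => ?_⟩
  · rw [htr, abs_of_nonpos (by linarith)]
    ring
  · have hdvd := sq_dvd_trace_sub_two_of_mem_Lam hγ
    have hne : Matrix.trace (γ : Matrix (Fin 2) (Fin 2) ℤ) - 2 ≠ 0 := by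
      intro h
      rw [sub_eq_zero.mp h] at hhyp
      norm_num at hhyp
    have hle := Int.le_of_dvd (abs_pos.mpr hne) ((dvd_abs _ _).mpr hdvd)
    have htri := abs_sub (Matrix.trace (γ : Matrix (Fin 2) (Fin 2) ℤ)) 2
    norm_num at htri
    linarith
end
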